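/- Let n ≥ 2 and let f_1, …, f_n be entire functions on ℂ satisfying e^{f_1} + ⋯ + e^{f_n} = 1 identically. Then f_i is constant for some i. -/

import Mathlib

open Complex Metric Real ValueDistribution

/-- The quantity whose powers bound small functions on `‖z‖ ≤ r`, in terms of the values of the
comparison function `T` at a larger radius `R`. -/
noncomputable def growthBase (T : ℝ → ℝ) (r R : ℝ) : ℝ := (1 + R) * (1 + T R) / (R - r)

/-- An entire function is small relative to `T` if it is bounded on `‖z‖ ≤ r` by a multiple of a
power of `growthBase T r R`, uniformly in `1 ≤ r < R`. -/
def IsSmall (T : ℝ → ℝ) (a : ℂ → ℂ) : Prop :=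
  Differentiable ℂ a ∧ ∃ C : ℝ, 0 ≤ C ∧ ∃ k : ℕ, ∀ r R : ℝ, 1 ≤ r → r < R →
    ∀ z : ℂ, ‖z‖ ≤ r → ‖a z‖ ≤ C * growthBase T r R ^ k

/-- A function is a small quotient if it is a quotient of two small entire functions. -/
def IsSmallQuotient (T : ℝ → ℝ) (F : ℂ → ℂ) : Prop :=
  ∃ b c : ℂ → ℂ, IsSmall T b ∧ IsSmall T c ∧ b ≠ 0 ∧ ∀ z, b z * F z = c z

section

variable {T : ℝ → ℝ} {a b f : ℂ → ℂ}

lemma one_le_growthBase (hT : ∀ R, 1 ≤ R → 0 ≤ T R) {r R : ℝ} (hr : 1 ≤ r) (hR : r < R) :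
    1 ≤ growthBase T r R := by
  have := hT R (by linarith)
  rw [growthBase, le_div_iff₀ (by linarith)]
  nlinarith

namespace IsSmall

lemma const (c : ℂ) : IsSmall T fun _ ↦ c :=
  ⟨differentiable_const c, ‖c‖, norm_nonneg c, 0, by simp⟩

lemma add (hT : ∀ R, 1 ≤ R → 0 ≤ T R) (ha : IsSmall T a) (hb : IsSmall T b) :
    IsSmall T fun z ↦ a z + b z := by
  obtain ⟨ha, C, hC, k, hk⟩ := ha
  obtain ⟨hb, D, hD, l, hl⟩ := hb
  refine ⟨ha.add hb, C + D, by positivity, k + l, fun r R hr hR z hz ↦ ?_⟩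
  have h1 := one_le_growthBase hT hr hR
  calc ‖a z + b z‖ ≤ ‖a z‖ + ‖b z‖ := norm_add_le _ _
    _ ≤ C * growthBase T r R ^ k + D * growthBase T r R ^ l :=
      add_le_add (hk r R hr hR z hz) (hl r R hr hR z hz)
    _ ≤ C * growthBase T r R ^ (k + l) + D * growthBase T r R ^ (k + l) := by
      gcongr <;> first | exact h1 | omega
    _ = _ := by ring

lemma mul (ha : IsSmall T a) (hb : IsSmall T b) : IsSmall T fun z ↦ a z * b z := by
  obtain ⟨ha, C, hC, k, hk⟩ := ha
  obtain ⟨hb, D, hD, l, hl⟩ := hb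
  refine ⟨ha.mul hb, C * D, by positivity, k + l, fun r R hr hR z hz ↦ ?_⟩
  calc ‖a z * b z‖ = ‖a z‖ * ‖b z‖ := norm_mul _ _
    _ ≤ (C * growthBase T r R ^ k) * (D * growthBase T r R ^ l) :=
      mul_le_mul (hk r R hr hR z hz) (hl r R hr hR z hz) (norm_nonneg _)
        ((norm_nonneg _).trans (hk r R hr hR z hz))
    _ = _ := by ring

lemma sub (hT : ∀ R, 1 ≤ R → 0 ≤ T R) (ha : IsSmall T a) (hb : IsSmall T b) :
    IsSmall T fun z ↦ a z - b z := by
  simpa [sub_eq_add_neg] using ha.add hT ((const (-1)).mul hb)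

lemma deriv (hT : ∀ R, 1 ≤ R → 0 ≤ T R) (ha : IsSmall T a) : IsSmall T (deriv a) := by
  obtain ⟨ha, C, hC, k, hk⟩ := ha
  refine ⟨ha.deriv, C * 2 ^ (k + 1), by positivity, k + 1, fun r R hr hR z hz ↦ ?_⟩
  have hd : 0 < (R - r) / 2 := by linarith
  have hTR := hT R (by linarith)
  have h1 := one_le_growthBase hT hr hR
  have hB : growthBase T ((r + R) / 2) R = 2 * growthBase T r R := by
    have : R - r ≠ 0 := by linarith
    rw [growthBase, growthBase, show R - (r + R) / 2 = (R - r) / 2 by ring]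
    field_simp
  have hinv : 1 / (R - r) ≤ growthBase T r R := by
    rw [growthBase]
    gcongr
    nlinarith
  have key := norm_deriv_le_of_forall_mem_sphere_norm_le (c := z) hd ha.diffContOnCl
    (C := C * (2 * growthBase T r R) ^ k) fun w hw ↦ by
      rw [← hB]
      refine hk _ _ (by linarith) (by linarith) w ?_
      have := norm_le_norm_add_norm_sub' w z
      rw [mem_sphere, dist_eq_norm] at hw
      linarith
  calc _ ≤ _ := key
    _ = C * (2 * growthBase T r R) ^ k * (2 * (1 / (R - r))) := by
      have : R - r ≠ 0 := by linarith
      field_simp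
    _ ≤ C * (2 * growthBase T r R) ^ k * (2 * growthBase T r R) := by gcongr
    _ = _ := by ring

end IsSmall

lemma Differentiable.eq_zero_or_eq_zero_of_mul_eq_zero (ha : Differentiable ℂ a)
    (hb : Differentiable ℂ b) (h : ∀ z, a z * b z = 0) : a = 0 ∨ b = 0 := by
  have := AnalyticOnNhd.eq_zero_or_eq_zero_of_mul_eq_zero
    (Complex.analyticOnNhd_univ_iff_differentiable.2 ha)
    (Complex.analyticOnNhd_univ_iff_differentiable.2 hb) (fun z _ ↦ h z) isPreconnected_univ
  simpa [funext_iff] using this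

/-- Two entire functions with vanishing Wronskian are proportional. -/
lemma exists_eq_const_mul_of_wronskian_eq_zero (ha : Differentiable ℂ a) (hb : Differentiable ℂ b)
    (hb0 : b ≠ 0) (h : ∀ z, b z * deriv a z = deriv b z * a z) :
    ∃ c : ℂ, ∀ z, a z = c * b z := by
  obtain ⟨z₀, hz₀⟩ := Function.ne_iff.1 hb0
  obtain ⟨ε, hε, hball⟩ := Metric.eventually_nhds_iff_ball.1
    (hb.continuous.continuousAt.eventually_ne hz₀)
  have hconst : ∀ z ∈ ball z₀ ε, a z = a z₀ / b z₀ * b z := fun z hz ↦ by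
    have hd : ∀ w ∈ ball z₀ ε, HasDerivAt (fun z ↦ a z / b z) 0 w := fun w hw ↦
      ((ha w).hasDerivAt.fun_div (hb w).hasDerivAt (hball w hw)).congr_deriv (by
        rw [mul_comm, h w]
        ring)
    have := (isOpen_ball.is_const_of_deriv_eq_zero (convex_ball z₀ ε).isPreconnected
      (fun w hw ↦ (hd w hw).differentiableAt.differentiableWithinAt)
      (fun w hw ↦ (hd w hw).deriv) hz (mem_ball_self hε))
    rw [← this, div_mul_cancel₀ _ (hball z hz)]
  refine ⟨a z₀ / b z₀, fun z ↦ congrFun (AnalyticOnNhd.eq_of_eventuallyEq (z₀ := z₀)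
    (Complex.analyticOnNhd_univ_iff_differentiable.2 ha)
    (Complex.analyticOnNhd_univ_iff_differentiable.2 (hb.const_mul _)) ?_) z⟩
  exact Filter.eventually_of_mem (ball_mem_nhds z₀ hε) hconst

lemma exists_isSmallQuotient_of_sum_eq {ι : Type*} [DecidableEq ι] (hT : ∀ R, 1 ≤ R → 0 ≤ T R)
    {f : ι → ℂ → ℂ} (Q : Finset ι) (hf : ∀ i ∈ Q, Differentiable ℂ (f i))
    (hf' : ∀ i ∈ Q, IsSmall T (deriv (f i))) (a : ι → ℂ → ℂ) (ha : ∀ i ∈ Q, IsSmall T (a i))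
    (e : ℂ → ℂ) (he : IsSmall T e) (he0 : e ≠ 0)
    (h : ∀ z, ∑ i ∈ Q, a i z * exp (f i z) = e z) :
    ∃ j ∈ Q, IsSmallQuotient T fun z ↦ exp (f j z) := by
  induction Q using Finset.strongInduction generalizing a e with
  | H Q ih =>
  obtain ⟨j, hj, hj0⟩ : ∃ j ∈ Q, a j ≠ 0 := by
    by_contra! H
    refine he0 (funext fun z ↦ ?_)
    rw [← h z]
    exact Finset.sum_eq_zero fun i hi ↦ by simp [H i hi]
  set d : ι → ℂ → ℂ := fun i z ↦ deriv (a i) z + deriv (f i) z * a i z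
  have hd_small : ∀ i ∈ Q, IsSmall T (d i) := fun i hi ↦
    ((ha i hi).deriv hT).add hT ((hf' i hi).mul (ha i hi))
  have hder : ∀ i ∈ Q, ∀ z, HasDerivAt (fun z ↦ a i z * exp (f i z)) (d i z * exp (f i z)) z :=
    fun i hi z ↦
      (((ha i hi).1 z).hasDerivAt.fun_mul (hf i hi z).hasDerivAt.cexp).congr_deriv (by ring)
  have hsum' : ∀ z, ∑ i ∈ Q, d i z * exp (f i z) = deriv e z := fun z ↦ by
    rw [← funext h, (HasDerivAt.fun_sum fun i hi ↦ hder i hi z).deriv]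
  by_cases hW : ∀ z, a j z * deriv e z - d j z * e z = 0
  · obtain ⟨c, hc⟩ := exists_eq_const_mul_of_wronskian_eq_zero (a := fun z ↦ a j z * exp (f j z))
      ((ha j hj).1.mul (hf j hj).cexp) he.1 he0 fun z ↦ by
        rw [(hder j hj z).deriv]
        linear_combination -exp (f j z) * hW z
    exact ⟨j, hj, a j, _, ha j hj, (IsSmall.const c).mul he, hj0, hc⟩
  · obtain ⟨i, hi, hi'⟩ := ih (Q.erase j) (Finset.erase_ssubset hj)
      (fun i hi ↦ hf i (Finset.mem_of_mem_erase hi))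
      (fun i hi ↦ hf' i (Finset.mem_of_mem_erase hi))
      (fun i z ↦ a j z * d i z - d j z * a i z)
      (fun i hi ↦ ((ha j hj).mul (hd_small i (Finset.mem_of_mem_erase hi))).sub hT
        ((hd_small j hj).mul (ha i (Finset.mem_of_mem_erase hi))))
      (fun z ↦ a j z * deriv e z - d j z * e z)
      (((ha j hj).mul (he.deriv hT)).sub hT ((hd_small j hj).mul he))
      (fun H ↦ hW fun z ↦ congrFun H z) fun z ↦ by
        rw [← hsum', ← h, Finset.mul_sum, Finset.mul_sum, ← Finset.sum_sub_distrib,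
          ← Finset.add_sum_erase _ _ hj, Finset.sum_congr rfl fun i _ ↦
            show (a j z * d i z - d j z * a i z) * exp (f i z) =
              a j z * (d i z * exp (f i z)) - d j z * (a i z * exp (f i z)) by ring]
        ring
    exact ⟨i, Finset.mem_of_mem_erase hi, hi'⟩

lemma isSmallQuotient_of_sum_eq {ι : Type*} [DecidableEq ι] (hT : ∀ R, 1 ≤ R → 0 ≤ T R)
    {f : ι → ℂ → ℂ} (Q : Finset ι) (hf : ∀ i ∈ Q, Differentiable ℂ (f i))
    (hf' : ∀ i ∈ Q, IsSmall T (deriv (f i)))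
    (hne : ∀ P ⊆ Q, P.Nonempty → ∃ z, ∑ i ∈ P, exp (f i z) ≠ 0)
    (h : IsSmallQuotient T fun z ↦ ∑ i ∈ Q, exp (f i z)) :
    ∀ j ∈ Q, IsSmallQuotient T fun z ↦ exp (f j z) := by
  induction Q using Finset.strongInduction with
  | H Q ih =>
  rcases Q.eq_empty_or_nonempty with rfl | hQ
  · simp
  obtain ⟨d, e, hd, he, hd0, hde⟩ := h
  have he0 : e ≠ 0 := by
    rintro rfl
    obtain ⟨z, hz⟩ := hne Q subset_rfl hQ
    rcases Differentiable.eq_zero_or_eq_zero_of_mul_eq_zero hd.1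
      (Differentiable.fun_sum fun i hi ↦ (hf i hi).cexp) hde with H | H
    exacts [hd0 H, hz (congrFun H z)]
  obtain ⟨j, hj, hj'⟩ := exists_isSmallQuotient_of_sum_eq hT Q hf hf' (fun _ ↦ d) (fun _ _ ↦ hd)
    e he he0 fun z ↦ by rw [← hde, Finset.mul_sum]
  obtain ⟨b, c, hb, hc, hb0, hbc⟩ := id hj'
  have hrest := ih (Q.erase j) (Finset.erase_ssubset hj)
    (fun i hi ↦ hf i (Finset.mem_of_mem_erase hi))
    (fun i hi ↦ hf' i (Finset.mem_of_mem_erase hi))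
    (fun P hP ↦ hne P (hP.trans (Finset.erase_subset _ _)))
    ⟨fun z ↦ d z * b z, fun z ↦ b z * e z - d z * c z, hd.mul hb,
      (hb.mul he).sub hT (hd.mul hc), fun H ↦ by
        rcases Differentiable.eq_zero_or_eq_zero_of_mul_eq_zero hd.1 hb.1 (congrFun H) with H | H
        exacts [hd0 H, hb0 H], fun z ↦ by
        have h1 := hde z
        have h2 := hbc z
        beta_reduce at h1 h2 ⊢
        rw [← Finset.add_sum_erase _ _ hj] at h1
        linear_combination b z * h1 - d z * h2⟩
  intro i hi
  rcases eq_or_ne i j with rfl | hij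
  · exact hj'
  · exact hrest i (Finset.mem_erase.2 ⟨hij, hi⟩)

lemma re_le_mul_proximity_exp (hf : Differentiable ℂ f) {R : ℝ} {z : ℂ} (hz : ‖z‖ < R) :
    (f z).re ≤ (R + ‖z‖) / (R - ‖z‖) * proximity (fun z ↦ exp (f z)) ⊤ R := by
  have hR : 0 < R := (norm_nonneg z).trans_lt hz
  have hw : z ∈ ball (0 : ℂ) R := by simpa using hz
  have hP := InnerProductSpace.HarmonicOnNhd.circleAverage_re_herglotzRieszKernel_smul
    (f := fun z ↦ (f z).re) (c := 0) (R := R)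
    (fun w _ ↦ (hf.analyticAt w).harmonicAt_re) hw
  have hlog : ∀ w, log⁺ ‖exp (f w)‖ = max 0 (f w).re := fun w ↦ by
    simp [posLog, norm_exp]
  have hcont : Continuous fun w ↦ (f w).re := continuous_re.comp hf.continuous
  rw [← hP, proximity_top, ← smul_eq_mul, ← Real.circleAverage_fun_smul]
  simp only [hlog]
  refine Real.circleAverage_mono ?_ ?_ fun w hws ↦ ?_
  · refine ContinuousOn.circleIntegrable hR.le (ContinuousOn.smul ?_ hcont.continuousOn)
    exact continuous_re.comp_continuousOn (abs_of_pos hR ▸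
      continuousOn_herglotzRieszKernel_sphere hw)
  · exact Continuous.continuousOn (by fun_prop) |>.circleIntegrable hR.le
  · rw [abs_of_pos hR] at hws
    have h1 := re_herglotzRieszKernel_le hws hw
    have h2 := le_re_herglotzRieszKernel hws hw
    have h3 : 0 ≤ (R - ‖z‖) / (R + ‖z‖) := div_nonneg (by linarith) (by positivity)
    simp only [Pi.smul_apply', Function.comp_apply, herglotzRieszKernel_def, smul_eq_mul]
    simp only [sub_zero] at h1 h2 ⊢
    have h4 := h3.trans h2
    calc _ ≤ _ * max 0 (f w).re := by gcongr; exact le_max_right _ _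
      _ ≤ _ := by gcongr

lemma isSmall_of_proximity_exp_le (hf : Differentiable ℂ f)
    (hT : ∀ R, 1 ≤ R → proximity (fun z ↦ exp (f z)) ⊤ R ≤ T R) : IsSmall T f := by
  refine ⟨hf, 32 * (1 + ‖f 0‖), by positivity, 2, fun r R hr hR z hz ↦ ?_⟩
  have hTR : 0 ≤ T R := (proximity_nonneg R).trans (hT R (by linarith))
  have hRr : 0 < R - r := by linarith
  have hR0 : 0 < R := by linarith
  set ρ := (r + R) / 2 with hρ
  set M := 4 * R * (1 + T R) / (R - r) with hM
  have hM0 : 0 < M := by positivity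
  have hMre : ∀ w ∈ ball (0 : ℂ) ρ, (f w).re ≤ M := fun w hw ↦ by
    have hw : ‖w‖ < ρ := by simpa using hw
    have hwR : (R - r) / 2 ≤ R - ‖w‖ := by linarith
    calc (f w).re ≤ (R + ‖w‖) / (R - ‖w‖) * proximity (fun z ↦ exp (f z)) ⊤ R :=
          re_le_mul_proximity_exp hf (by linarith)
      _ ≤ (R + R) / ((R - r) / 2) * (1 + T R) := by
        gcongr
        · exact proximity_nonneg R
        · linarith
        · linarith [hT R (by linarith)]
      _ = M := by rw [hM]; field_simp; ring
  have key := borelCaratheodory hM0 hf.differentiableOn hMre (by linarith)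
    (z := z) (by simp only [mem_ball, dist_zero_right]; linarith)
  have hρz : (R - r) / 2 ≤ ρ - ‖z‖ := by linarith
  have hB1 : M ≤ 4 * growthBase T r R := by
    rw [hM, growthBase, mul_div_assoc', mul_assoc]
    gcongr
    linarith
  have hB2 : R / (R - r) ≤ growthBase T r R := by
    rw [growthBase]
    gcongr
    nlinarith
  have hB0 : 1 ≤ growthBase T r R := by
    rw [growthBase, le_div_iff₀ hRr]
    nlinarith
  calc ‖f z‖ ≤ 2 * M * ‖z‖ / (ρ - ‖z‖) + ‖f 0‖ * (ρ + ‖z‖) / (ρ - ‖z‖) := key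
    _ ≤ 2 * M * R / ((R - r) / 2) + ‖f 0‖ * (R + R) / ((R - r) / 2) := by
      gcongr <;> linarith
    _ = 4 * (M + ‖f 0‖) * (R / (R - r)) := by field_simp; ring
    _ ≤ 4 * (4 * growthBase T r R + ‖f 0‖ * growthBase T r R) * growthBase T r R := by
      gcongr
      exact le_mul_of_one_le_right (norm_nonneg (f 0)) hB0
    _ ≤ _ := by nlinarith [norm_nonneg (f 0), sq_nonneg (growthBase T r R)]

lemma logCounting_top_eq_zero (hf : Differentiable ℂ f) : logCounting f ⊤ = 0 := by
  have h0 : (MeromorphicOn.divisor f Set.univ)⁻ = 0 := by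
    rw [negPart_eq_zero]
    exact MeromorphicOn.AnalyticOnNhd.divisor_nonneg
      (Complex.analyticOnNhd_univ_iff_differentiable.2 hf)
  rw [logCounting_top, h0, map_zero]

lemma characteristic_top_eq_proximity (hf : Differentiable ℂ f) :
    characteristic f ⊤ = proximity f ⊤ := by
  rw [characteristic, logCounting_top_eq_zero hf, add_zero]

lemma IsSmall.exists_proximity_le (hT : ∀ R, 1 ≤ R → 0 ≤ T R) (ha : IsSmall T a) :
    ∃ C : ℝ, 0 ≤ C ∧ ∃ k : ℕ, ∀ r R, 1 ≤ r → r < R →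
      proximity a ⊤ r ≤ C + k * Real.log (growthBase T r R) := by
  obtain ⟨had, C, hC, k, hk⟩ := ha
  refine ⟨Real.log (1 + C), Real.log_nonneg (by linarith), k, fun r R hr hR ↦ ?_⟩
  have hB := one_le_growthBase hT hr hR
  have hmer : Meromorphic a := fun z ↦ (had.analyticAt z).meromorphicAt
  rw [proximity_top]
  refine Real.circleAverage_mono_on_of_le_circle
    hmer.meromorphicOn.circleIntegrable_posLog_norm fun z hz ↦ ?_
  rw [abs_of_pos (by linarith)] at hz
  have hz : ‖z‖ ≤ r := by simpa using hz.le
  rw [← Real.log_pow, ← Real.log_mul (by positivity) (by positivity)]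
  have h1 : 1 ≤ (1 + C) * growthBase T r R ^ k := by
    have := one_le_pow₀ hB (n := k)
    nlinarith
  rw [← posLog_eq_log (by rwa [abs_of_nonneg (by positivity)])]
  refine posLog_le_posLog (norm_nonneg _) ((hk r R hr hR z hz).trans ?_)
  gcongr
  linarith

lemma IsSmallQuotient.exists_proximity_le (hT : ∀ R, 1 ≤ R → 0 ≤ T R) (ha : IsSmallQuotient T a) :
    ∃ C : ℝ, 0 ≤ C ∧ ∃ k : ℕ, ∀ r R, 1 ≤ r → r < R →
      proximity a ⊤ r ≤ C + k * Real.log (growthBase T r R) := by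
  obtain ⟨b, c, hb, hc, hb0, hbc⟩ := ha
  obtain ⟨C, hC, k, hk⟩ := hb.exists_proximity_le hT
  obtain ⟨D, hD, l, hl⟩ := hc.exists_proximity_le hT
  have hbm : Meromorphic b := fun z ↦ (hb.1.analyticAt z).meromorphicAt
  have hcm : Meromorphic c := fun z ↦ (hc.1.analyticAt z).meromorphicAt
  set E := max |Real.log ‖b 0‖| |Real.log ‖meromorphicTrailingCoeffAt b 0‖|
  refine ⟨C + D + E, by positivity, k + l, fun r R hr hR ↦ ?_⟩
  obtain ⟨z₀, hz₀⟩ := Function.ne_iff.1 hb0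
  have hcongr : a =ᶠ[Filter.codiscrete ℂ] b⁻¹ * c := by
    filter_upwards [AnalyticOnNhd.preimage_zero_mem_codiscrete
      (Complex.analyticOnNhd_univ_iff_differentiable.2 hb.1) hz₀] with z hz
    have hz : b z ≠ 0 := by simpa using hz
    simp [← hbc z, hz]
  have h1 := proximity_mul_top_le hbm.inv hcm r
  have h2 := (abs_le.1 (characteristic_sub_characteristic_inv_le hbm (R := r))).1
  have h3 : 0 ≤ logCounting b⁻¹ ⊤ r := logCounting_nonneg hr
  have h4 := hk r R hr hR
  have h5 := hl r R hr hR
  rw [characteristic_top_eq_proximity hb.1, characteristic] at h2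
  rw [proximity_congr_codiscrete hcongr (by linarith)]
  simp only [Pi.add_apply] at h1 h2
  push_cast
  linarith

lemma one_le_log_two_add {r : ℝ} (hr : 1 ≤ r) : 1 ≤ Real.log (2 + r) := by
  rw [Real.le_log_iff_exp_le (by linarith)]
  linarith [Real.exp_one_lt_three]

lemma mul_log_one_add_le {k x : ℝ} (hk : 0 ≤ k) (hx : 0 ≤ x) :
    k * Real.log (1 + x) ≤ x / 4 + (1 / 4 + k * Real.log (4 * k + 1)) := by
  have h : Real.log (1 + x) ≤ (1 + x) / (4 * k + 1) + Real.log (4 * k + 1) := by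
    have := Real.log_le_sub_one_of_pos (x := (1 + x) / (4 * k + 1)) (by positivity)
    rw [Real.log_div (by positivity) (by positivity)] at this
    linarith
  have h' : k * ((1 + x) / (4 * k + 1)) ≤ (1 + x) / 4 := by
    rw [mul_div_assoc', div_le_div_iff₀ (by positivity) (by positivity)]
    nlinarith
  nlinarith [mul_le_mul_of_nonneg_left h hk]

/-- Borel's growth argument: a nonnegative monotone function that is bounded at `r` by the
logarithm of `growthBase T r R` for all `R > r` grows at most logarithmically. -/
lemma exists_le_mul_log_of_le_log_growthBase (hT : ∀ R, 1 ≤ R → 0 ≤ T R)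
    (hmono : ∀ r R, 1 ≤ r → r ≤ R → T r ≤ T R) {C k : ℝ} (hC : 0 ≤ C) (hk : 0 ≤ k)
    (h : ∀ r R, 1 ≤ r → r < R → T r ≤ C + k * Real.log (growthBase T r R)) :
    ∃ A, 0 ≤ A ∧ ∀ r, 1 ≤ r → T r ≤ A * Real.log (2 + r) := by
  set c := 1 / 4 + k * Real.log (4 * k + 1)
  have hc : 0 ≤ c := by
    have := Real.log_nonneg (x := 4 * k + 1) (by linarith)
    positivity
  refine ⟨4 / 3 * (C + c + 2 * k) + 4 / 9 * k, by positivity, fun r hr ↦ ?_⟩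
  have hlog := one_le_log_two_add hr
  set D := C + k * Real.log (2 + r) + k + c with hD
  set α := 4 / 3 * D + 4 / 9 * k with hα
  set s : ℕ → ℝ := fun n ↦ r + 1 - (1 / 2) ^ n with hs
  have hs1 : ∀ n, r ≤ s n := fun n ↦ by
    have : (1 / 2 : ℝ) ^ n ≤ 1 := pow_le_one₀ (by norm_num) (by norm_num)
    simp only [hs]
    linarith
  have hs2 : ∀ n, s n ≤ r + 1 := fun n ↦ by
    simp only [hs]
    linarith [show (0 : ℝ) < (1 / 2) ^ n by positivity]
  have hs3 : ∀ n, s (n + 1) - s n = (1 / 2) ^ (n + 1) := fun n ↦ by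
    simp only [hs]
    ring
  have hstep : ∀ n, T (s n) ≤ D + k * n + T (s (n + 1)) / 4 := fun n ↦ by
    have hpos : (0 : ℝ) < (1 / 2) ^ (n + 1) := by positivity
    have hlt : s n < s (n + 1) := by linarith [hs3 n]
    have hTs := hT (s (n + 1)) (by linarith [hs1 (n + 1)])
    have hs0 := hs1 (n + 1)
    have h1 := h (s n) (s (n + 1)) (by linarith [hs1 n]) hlt
    have h2 : Real.log (growthBase T (s n) (s (n + 1))) ≤
        Real.log (2 + r) + Real.log (1 + T (s (n + 1))) + (n + 1) := by
      rw [growthBase, hs3, Real.log_div (mul_pos (by linarith) (by linarith)).ne' hpos.ne',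
        Real.log_mul (by linarith) (by linarith), Real.log_pow, one_div, Real.log_inv]
      have h3 : Real.log (1 + s (n + 1)) ≤ Real.log (2 + r) :=
        Real.log_le_log (by linarith) (by linarith [hs2 (n + 1)])
      have h4 : Real.log 2 ≤ 1 := by linarith [Real.log_two_lt_d9]
      push_cast
      nlinarith [mul_le_mul_of_nonneg_left h4 (show (0 : ℝ) ≤ n + 1 by positivity)]
    have h5 : k * Real.log (1 + T (s (n + 1))) ≤ T (s (n + 1)) / 4 + c :=
      mul_log_one_add_le hk hTs
    have h6 := mul_le_mul_of_nonneg_left h2 hk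
    rw [hD]
    linarith
  have hiter : ∀ n : ℕ, T r ≤ α + (T (s n) - α - 4 / 3 * k * n) * (1 / 4) ^ n := fun n ↦ by
    induction n with
    | zero => simp [hs]
    | succ n ih =>
      refine ih.trans ?_
      have := mul_le_mul_of_nonneg_right (hstep n) (show (0 : ℝ) ≤ (1 / 4) ^ n by positivity)
      rw [pow_succ]
      push_cast
      rw [hα]
      linarith
  have hD0 : 0 ≤ D := by positivity
  have hbound : ∀ n : ℕ, T r ≤ α + T (r + 1) * (1 / 4) ^ n := fun n ↦ by
    refine (hiter n).trans ?_
    gcongr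
    have h1 := hmono (s n) (r + 1) (by linarith [hs1 n]) (hs2 n)
    have h2 : 0 ≤ 4 / 3 * k * n := by positivity
    have h3 : 0 ≤ α := by positivity
    linarith
  have hle : T r ≤ α := by
    refine ge_of_tendsto' (x := Filter.atTop) ?_ hbound
    simpa using ((tendsto_pow_atTop_nhds_zero_of_lt_one (r := (1 / 4 : ℝ)) (by norm_num)
      (by norm_num)).const_mul (T (r + 1))).const_add α
  refine hle.trans ?_
  rw [hα, hD]
  nlinarith [mul_nonneg (add_nonneg (add_nonneg hC hc) hk) (sub_nonneg.2 hlog),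
    mul_nonneg hk (sub_nonneg.2 hlog)]

lemma IsSmall.apply_eq_apply_of_le_mul_log (hT : ∀ R, 1 ≤ R → 0 ≤ T R) (ha : IsSmall T a) {A : ℝ}
    (hA : 0 ≤ A) (hlog : ∀ r, 1 ≤ r → T r ≤ A * Real.log (2 + r)) (z w : ℂ) : a z = a w := by
  obtain ⟨had, C, hC, k, hk⟩ := ha
  refine is_const_of_deriv_eq_zero had (fun z ↦ ?_) z w
  have hlim : Filter.Tendsto (fun u : ℝ ↦ C * (3 * (A + 1)) ^ k * 8 * (Real.log u ^ k / u))
      Filter.atTop (nhds 0) := by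
    simpa using ((isLittleO_pow_log_id_atTop (n := k)).tendsto_div_nhds_zero).const_mul
      (C * (3 * (A + 1)) ^ k * 8)
  refine norm_le_zero_iff.1 (ge_of_tendsto hlim ?_)
  filter_upwards [Filter.eventually_ge_atTop (6 + 4 * ‖z‖)] with u hu
  have hz := norm_nonneg z
  set ρ := (u - 2) / 4 with hρ
  have hρ1 : 1 ≤ ρ := by linarith
  have hρz : ‖z‖ ≤ ρ := by linarith
  have hu' : 2 + 4 * ρ = u := by rw [hρ]; ring
  have hL := one_le_log_two_add (r := 4 * ρ) (by linarith)
  have hTρ := hlog (4 * ρ) (by linarith)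
  have hTρ0 := hT (4 * ρ) (by linarith)
  rw [hu'] at hL hTρ
  have hB : growthBase T (2 * ρ) (4 * ρ) ≤ 3 * (A + 1) * Real.log u := by
    rw [growthBase, div_le_iff₀ (by linarith)]
    have h1 : 1 + T (4 * ρ) ≤ (A + 1) * Real.log u := by linarith
    have h2 : 1 + 4 * ρ ≤ 3 * (4 * ρ - 2 * ρ) := by linarith
    calc _ ≤ (3 * (4 * ρ - 2 * ρ)) * ((A + 1) * Real.log u) := by gcongr; linarith
      _ = _ := by ring
  have hB0 := one_le_growthBase hT (r := 2 * ρ) (R := 4 * ρ) (by linarith) (by linarith)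
  have key := norm_deriv_le_of_forall_mem_sphere_norm_le (c := z) (R := ρ) (by linarith)
    had.diffContOnCl (C := C * growthBase T (2 * ρ) (4 * ρ) ^ k) fun w hw ↦
      hk _ _ (by linarith) (by linarith) w (by
        have := norm_le_norm_add_norm_sub' w z
        rw [mem_sphere, dist_eq_norm] at hw
        linarith)
  calc _ ≤ _ := key
    _ ≤ C * (3 * (A + 1) * Real.log u) ^ k / (u / 8) := by
      gcongr
      · linarith
      · linarith
    _ = _ := by rw [mul_pow]; field_simp

lemma exists_minimal_sum_eq {ι M : Type*} [DecidableEq ι] [AddCommGroup M] (S : Finset ι)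
    (g : ι → M) : ∃ P ⊆ S, ∑ i ∈ P, g i = ∑ i ∈ S, g i ∧
      ∀ Q ⊆ P, Q.Nonempty → ∑ i ∈ Q, g i ≠ 0 := by
  induction S using Finset.strongInduction with
  | H S ih =>
  by_cases H : ∀ Q ⊆ S, Q.Nonempty → ∑ i ∈ Q, g i ≠ 0
  · exact ⟨S, subset_rfl, rfl, H⟩
  · push Not at H
    obtain ⟨Q, hQS, hQ, hQ0⟩ := H
    obtain ⟨P, hP, hsum, hmin⟩ := ih (S \ Q) (Finset.sdiff_ssubset hQS hQ)
    refine ⟨P, hP.trans Finset.sdiff_subset, ?_, hmin⟩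
    rw [hsum, ← Finset.sum_sdiff hQS, hQ0, add_zero]

/-- If exponentials of entire functions sum to one and no nonempty subsum vanishes identically,
then all the exponents are constant. -/
theorem apply_eq_apply_of_sum_exp_eq_one {ι : Type*} [DecidableEq ι] (S : Finset ι)
    {f : ι → ℂ → ℂ} (hf : ∀ i ∈ S, Differentiable ℂ (f i)) (hsum : ∀ z, ∑ i ∈ S, exp (f i z) = 1)
    (hne : ∀ P ⊆ S, P.Nonempty → ∃ z, ∑ i ∈ P, exp (f i z) ≠ 0) :
    ∀ i ∈ S, ∀ z w, f i z = f i w := by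
  set T : ℝ → ℝ := fun r ↦ ∑ i ∈ S, proximity (fun z ↦ exp (f i z)) ⊤ r
  have hT : ∀ R, 1 ≤ R → 0 ≤ T R := fun R _ ↦ Finset.sum_nonneg fun i _ ↦ proximity_nonneg R
  have hmono : ∀ r R, 1 ≤ r → r ≤ R → T r ≤ T R := fun r R hr hR ↦
    Finset.sum_le_sum fun i hi ↦ by
      rw [← characteristic_top_eq_proximity (hf i hi).cexp]
      exact characteristic_monotoneOn (fun z ↦ ((hf i hi).cexp.analyticAt z).meromorphicAt)
        (Set.mem_Ioi.2 (by linarith)) (Set.mem_Ioi.2 (by linarith)) hR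
  have hsmall : ∀ i ∈ S, IsSmall T (f i) := fun i hi ↦
    isSmall_of_proximity_exp_le (hf i hi) fun R _ ↦
      Finset.single_le_sum (f := fun i ↦ proximity (fun z ↦ exp (f i z)) ⊤ R)
        (fun i _ ↦ proximity_nonneg R) hi
  have hquot := isSmallQuotient_of_sum_eq hT S hf (fun i hi ↦ (hsmall i hi).deriv hT) hne
    ⟨fun _ ↦ 1, fun _ ↦ 1, IsSmall.const 1, IsSmall.const 1,
      fun H ↦ one_ne_zero (congrFun H 0), fun z ↦ by simp [hsum]⟩
  have hbound : ∀ i, ∃ C : ℝ, 0 ≤ C ∧ ∃ k : ℕ, i ∈ S → ∀ r R, 1 ≤ r → r < R →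
      proximity (fun z ↦ exp (f i z)) ⊤ r ≤ C + k * Real.log (growthBase T r R) := fun i ↦ by
    by_cases hi : i ∈ S
    · obtain ⟨C, hC, k, hk⟩ := (hquot i hi).exists_proximity_le hT
      exact ⟨C, hC, k, fun _ ↦ hk⟩
    · exact ⟨0, le_rfl, 0, fun h ↦ absurd h hi⟩
  choose C hC k hk using hbound
  obtain ⟨A, hA, hlog⟩ := exists_le_mul_log_of_le_log_growthBase hT hmono
    (C := ∑ i ∈ S, C i) (k := ∑ i ∈ S, (k i : ℝ)) (Finset.sum_nonneg fun i _ ↦ hC i)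
    (by positivity) fun r R hr hR ↦ by
      rw [Finset.sum_mul, ← Finset.sum_add_distrib]
      exact Finset.sum_le_sum fun i hi ↦ hk i hi r R hr hR
  exact fun i hi ↦ (hsmall i hi).apply_eq_apply_of_le_mul_log hT hA hlog

end

/-- Borel's lemma: if `f₁, …, fₙ` (`n ≥ 2`) are entire functions with
`e^{f₁} + ⋯ + e^{fₙ} = 1` identically, then some `fᵢ` is constant. -/
theorem stmt_17 (n : ℕ) (hn : 2 ≤ n) (f : Fin n → ℂ → ℂ)
    (hf : ∀ i, Differentiable ℂ (f i))
    (hsum : ∀ z : ℂ, ∑ i, Complex.exp (f i z) = 1) :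
    ∃ i, ∀ z w : ℂ, f i z = f i w := by
  obtain ⟨P, -, hP, hmin⟩ := exists_minimal_sum_eq Finset.univ fun i z ↦ exp (f i z)
  have hP1 : ∀ z, ∑ i ∈ P, exp (f i z) = 1 := fun z ↦ by
    simpa [Finset.sum_apply, hsum] using congrFun hP z
  obtain ⟨i, hi⟩ : P.Nonempty := by
    rw [Finset.nonempty_iff_ne_empty]
    rintro rfl
    simpa using hP1 0
  refine ⟨i, apply_eq_apply_of_sum_exp_eq_one P (fun i _ ↦ hf i) hP1 (fun Q hQ hQne ↦ ?_) i hi⟩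
  simpa [Function.ne_iff, Finset.sum_apply] using hmin Q hQ hQne
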